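/- Recursive estimate on the badness probability. Let Γ, γ be moderately steep scales and let Q be a probability measure on {0,1}^{ℤ^d} satisfying the decay condition (smin) with constants b'', B''. Define p_k := sup_{x∈ℤ^d} Q(x ∈ B_k(ω)) for k ≥ 0, and for x ∈ ℤ^d let A_{k+1}(x) := O_{γ_{k+1}+Γ_{k+1}}(x) ∖ O_{(Γ_{k+1}−1)/2}(x) and |A_{k+1}| its cardinality (which does not depend on x). Then for every k ≥ 0, p_{k+1} ≤ |A_{k+1}|·(p_k² + B''·|O_{θ_k}(0)|·exp{−b''Γ_{k+1}/20}). -/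

import Mathlib

namespace Paper

open MeasureTheory

noncomputable section

/-- The lattice `ℤ^d`. -/
abbrev ZLat (d : ℕ) := Fin d → ℤ

/-- A disorder configuration `ω ∈ {0,1}^{ℤ^d}` (`true` = bad site). -/
abbrev DConf (d : ℕ) := ZLat d → Bool

/-- The `ℓ¹` distance on `ℤ^d`. -/
def D1 {d : ℕ} (x y : ZLat d) : ℕ := ∑ i, (x i - y i).natAbs

/-- The sup distance on `ℤ^d`. -/
def supD {d : ℕ} (x y : ZLat d) : ℕ := Finset.univ.sup fun i => (x i - y i).natAbs

/-- The `ℓ¹` ball `O_r(x)` of (real) radius `r` around `x`. -/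
def ball1 {d : ℕ} (x : ZLat d) (r : ℝ) : Set (ZLat d) := {y | (D1 x y : ℝ) ≤ r}

/-- The `ℓ¹` neighborhood `O_r(X)` of a set `X`. -/
def nbd1 {d : ℕ} (X : Set (ZLat d)) (r : ℝ) : Set (ZLat d) :=
  {y | ∃ x ∈ X, (D1 x y : ℝ) ≤ r}

/-- The σ-algebra `𝒜_Λ` generated by the coordinates in `Λ`. -/
def cylSigma {d : ℕ} (Λ : Set (ZLat d)) : MeasurableSpace (DConf d) :=
  MeasurableSpace.comap (fun ω => fun x : Λ => ω x) inferInstance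

/-- `f` is a local function with support contained in the finite set `S`. -/
def LocalOn {d : ℕ} (f : DConf d → ℝ) (S : Finset (ZLat d)) : Prop :=
  ∀ σ τ : DConf d, (∀ x ∈ S, σ x = τ x) → f σ = f τ

/-- Sup norm of a real valued function. -/
def supNorm {α : Type*} (f : α → ℝ) : ℝ := ⨆ a, |f a|

/-- The `ℓ¹` distance between two finite subsets of the lattice. -/
def fDist1 {d : ℕ} (A B : Finset (ZLat d)) : ℝ :=
  sInf ((fun p : ZLat d × ZLat d => (D1 p.1 p.2 : ℝ)) '' {p | p.1 ∈ A ∧ p.2 ∈ B})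

/-- The decay condition (smin): exponential decay of correlations of `Q`. -/
def Smin {d : ℕ} (Q : Measure (DConf d)) (b'' B'' : ℝ) : Prop :=
  ∀ (f g : DConf d → ℝ) (Sf Sg : Finset (ZLat d)),
    LocalOn f Sf → LocalOn g Sg →
    (min Sf.card Sg.card : ℝ) * Real.exp (-b'' * fDist1 Sf Sg) ≤ 1 →
    |(∫ ω, f ω * g ω ∂Q) - (∫ ω, f ω ∂Q) * ∫ ω, g ω ∂Q| ≤
      B'' * supNorm f * supNorm g * (min Sf.card Sg.card : ℝ) *
        Real.exp (-b'' * fDist1 Sf Sg)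

/-- `θ_j = ∑_{i=0}^{j} (Γ_i + γ_i)`. -/
def theta (Γ γ : ℕ → ℝ) (j : ℕ) : ℝ := ∑ i ∈ Finset.range (j + 1), (Γ i + γ i)

/-- Moderately steep scales, with parameters `a > 0` and `ε ∈ (0,1)`
(items (1)–(5) of the definition). -/
structure ModSteep (d : ℕ) (Γ γ : ℕ → ℝ) (a ε : ℝ) : Prop where
  gammaBigMono : StrictMono Γ
  gammaSmallMono : StrictMono γ
  gammaBigZero : Γ 0 = 0
  gammaSmallZero : 0 ≤ γ 0
  gammaBigOne : 2 ≤ Γ 1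
  halfLt : ∀ j : ℕ, 1 ≤ j → Γ j < γ j / 2
  lam : ∀ j : ℕ, 10 * theta Γ γ j ≤ Γ (j + 1)
  covolSummable : Summable (fun j : ℕ => if j = 0 then (0 : ℝ) else Γ j / γ j)
  covol : (∑' j : ℕ, if j = 0 then (0 : ℝ) else Γ j / γ j) ≤ 1 / 2
  apos : 0 < a
  epsMem : ε ∈ Set.Ioo (0 : ℝ) 1
  growth : ∀ k : ℕ, 2 * 3 ^ d * theta Γ γ (k + 1) ^ d ≤ Real.exp (a * (1 + ε) ^ k)
  tail : ∀ s : ℝ, 0 ≤ s → ∀ q : ℝ, 1 < q →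
    Summable fun k : ℕ => theta Γ γ k ^ s * Real.exp (-a * (1 + ε) ^ k / q)

/-- `x` is a gentle point at level `k ≥ 1` with respect to the set `Bprev` of
`(k-1)`-bad points: `x ∈ Bprev`, the atom `A = O_{Γ_k}(x) ∩ Bprev` has `ℓ¹` diameter
at most `Γ_k`, and `D(A, Bprev ∖ A) > γ_k`. -/
def gentleOn {d : ℕ} (Γ γ : ℕ → ℝ) (Bprev : Set (ZLat d)) (k : ℕ) (x : ZLat d) : Prop :=
  x ∈ Bprev ∧
  (∀ u ∈ ball1 x (Γ k) ∩ Bprev, ∀ v ∈ ball1 x (Γ k) ∩ Bprev, (D1 u v : ℝ) ≤ Γ k) ∧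
  (∀ u ∈ ball1 x (Γ k) ∩ Bprev, ∀ v ∈ Bprev \ (ball1 x (Γ k) ∩ Bprev),
    γ k < (D1 u v : ℝ))

/-- The recursive classification of badness: `B_0(ω) = {x : ω_x = 1}` and
`B_k(ω) = B_{k-1}(ω)` minus the `k`-gentle points. -/
def badSet {d : ℕ} (Γ γ : ℕ → ℝ) (ω : DConf d) : ℕ → Set (ZLat d)
  | 0 => {x | ω x = true}
  | k + 1 => {x | x ∈ badSet Γ γ ω k ∧ ¬ gentleOn Γ γ (badSet Γ γ ω k) (k + 1) x}

/-- The `k`-gentle sites: `G_0(ω) = {x : ω_x = 0}`, `G_k(ω) = B_{k-1}(ω) ∖ B_k(ω)`. -/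
def gentleSet {d : ℕ} (Γ γ : ℕ → ℝ) (ω : DConf d) : ℕ → Set (ZLat d)
  | 0 => {x | ω x = false}
  | k + 1 => badSet Γ γ ω k \ badSet Γ γ ω (k + 1)

/-- The collection of `k`-gentle atoms `𝒢_k(ω)` (for `k ≥ 1`):
`A = O_{Γ_k}(x) ∩ B_{k-1}(ω)` for `x` a `k`-gentle point. -/
def atomsAt {d : ℕ} (Γ γ : ℕ → ℝ) (ω : DConf d) (k : ℕ) : Set (Set (ZLat d)) :=
  {A | ∃ x : ZLat d, gentleOn Γ γ (badSet Γ γ ω (k - 1)) k x ∧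
        A = ball1 x (Γ k) ∩ badSet Γ γ ω (k - 1)}

/-- The smallest coordinate parallelepiped `Env(g)` containing `g`. -/
def env {d : ℕ} (g : Set (ZLat d)) : Set (ZLat d) :=
  {x | ∀ i : Fin d, (∃ u ∈ g, u i ≤ x i) ∧ ∃ v ∈ g, x i ≤ v i}

/-- The residual bad sets of a graded family of atoms:
`B_0 = 𝕃 ∖ G_0`, `B_j = B_{j-1} ∖ ⋃(atoms of grade j)`. -/
def Bres {d : ℕ} (G0 : Set (ZLat d)) (atoms : ℕ → Set (Set (ZLat d))) : ℕ → Set (ZLat d)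
  | 0 => G0ᶜ
  | k + 1 => Bres G0 atoms k \ ⋃ g ∈ atoms (k + 1), g

/-- A gentle disintegration of `ℤ^d` with respect to `G0` and the scales `Γ, γ`. -/
structure GentleDisintegration (d : ℕ) (G0 : Set (ZLat d)) (Γ γ : ℕ → ℝ) where
  atoms : ℕ → Set (Set (ZLat d))
  atomFinite : ∀ j, ∀ g ∈ atoms j, g.Finite
  atomNonempty : ∀ j, ∀ g ∈ atoms j, g.Nonempty
  uniqueGrade : ∀ j j' g, g ∈ atoms j → g ∈ atoms j' → j = j'
  pairwiseDisjoint : ∀ j j' g g', g ∈ atoms j → g' ∈ atoms j' → g ≠ g' → Disjoint g g'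
  cover : ∀ x : ZLat d, ∃ j, ∃ g ∈ atoms j, x ∈ g
  grade0 : atoms 0 = {s | ∃ x ∈ G0, s = {x}}
  subsBad : ∀ j, ∀ g ∈ atoms (j + 1), g ⊆ Bres G0 atoms j
  diamBound : ∀ j, 1 ≤ j → ∀ g ∈ atoms j, ∀ u ∈ g, ∀ v ∈ g, (D1 u v : ℝ) ≤ Γ j
  separation : ∀ j, ∀ g ∈ atoms (j + 1), ∀ u ∈ g, ∀ v ∈ Bres G0 atoms j \ g,
    γ (j + 1) < (D1 u v : ℝ)
  horizon : ∀ x : ZLat d,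
    {j : ℕ | 1 ≤ j ∧ ∃ g ∈ atoms j, ∃ y ∈ env g, (supD x y : ℝ) ≤ theta Γ γ j}.Finite


/-- The annulus `A_{k}(x) = O_{γ_k+Γ_k}(x) ∖ O_{(Γ_k−1)/2}(x)`. -/
def annulus {d : ℕ} (Γ γ : ℕ → ℝ) (k : ℕ) (x : ZLat d) : Set (ZLat d) :=
  ball1 x (γ k + Γ k) \ ball1 x ((Γ k - 1) / 2)

lemma D1_self {d : ℕ} (x : ZLat d) : D1 x x = 0 := by simp [D1]

lemma D1_comm {d : ℕ} (x y : ZLat d) : D1 x y = D1 y x :=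
  Finset.sum_congr rfl fun i _ => by omega

lemma D1_triangle {d : ℕ} (x y z : ZLat d) : D1 x z ≤ D1 x y + D1 y z := by
  unfold D1
  rw [← Finset.sum_add_distrib]
  exact Finset.sum_le_sum fun i _ => by omega

lemma D1_triangle_real {d : ℕ} (x y z : ZLat d) : (D1 x z : ℝ) ≤ D1 x y + D1 y z := by
  exact_mod_cast D1_triangle x y z

lemma natAbs_sub_le_D1 {d : ℕ} (x y : ZLat d) (i : Fin d) : (x i - y i).natAbs ≤ D1 x y :=
  Finset.single_le_sum (f := fun i => (x i - y i).natAbs) (fun _ _ => Nat.zero_le _)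
    (Finset.mem_univ i)

lemma D1_add_left {d : ℕ} (x y z : ZLat d) : D1 (x + y) (x + z) = D1 y z := by
  simp [D1]

lemma D1_zero_single {d : ℕ} (i : Fin d) (t : ℤ) : D1 0 (Pi.single i t) = t.natAbs := by
  unfold D1
  rw [Finset.sum_eq_single i]
  · simp
  · intro j _ hj
    simp [hj]
  · simp

lemma ball1_finite {d : ℕ} (x : ZLat d) (r : ℝ) : (ball1 x r).Finite := by
  refine (Set.finite_Icc (fun i => x i - (⌊r⌋₊ : ℤ)) (fun i => x i + (⌊r⌋₊ : ℤ))).subset ?_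
  intro y hy
  have h : D1 x y ≤ ⌊r⌋₊ := Nat.le_floor hy
  have key (i : Fin d) : (x i - y i).natAbs ≤ ⌊r⌋₊ := (natAbs_sub_le_D1 x y i).trans h
  constructor <;> intro i <;> have := key i <;> simp only [] <;> omega

lemma ball1_eq_image {d : ℕ} (x : ZLat d) (r : ℝ) :
    ball1 x r = (x + ·) '' ball1 0 r := by
  ext y
  simp only [ball1, Set.mem_image, Set.mem_ofPred_eq]
  constructor
  · intro h
    refine ⟨y - x, ?_, by simp⟩
    rw [← D1_add_left x]
    simpa using h
  · rintro ⟨z, hz, rfl⟩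
    rw [← D1_add_left x] at hz
    simpa using hz

lemma ncard_ball1 {d : ℕ} (x : ZLat d) (r : ℝ) : (ball1 x r).ncard = (ball1 (0 : ZLat d) r).ncard := by
  rw [ball1_eq_image, Set.ncard_image_of_injective _ (add_right_injective x)]

lemma annulus_finite {d : ℕ} (Γ γ : ℕ → ℝ) (k : ℕ) (x : ZLat d) : (annulus Γ γ k x).Finite :=
  (ball1_finite _ _).subset Set.sdiff_subset

lemma ncard_annulus {d : ℕ} (Γ γ : ℕ → ℝ) (k : ℕ) (x : ZLat d) :
    (annulus Γ γ k x).ncard = (annulus Γ γ k (0 : ZLat d)).ncard := by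
  rw [annulus, ball1_eq_image, ball1_eq_image x, ← Set.image_sdiff (add_right_injective x),
    Set.ncard_image_of_injective _ (add_right_injective x), ← annulus]

/-- Four disjoint translates of a small ball fit into a wide annulus. -/
lemma four_mul_ncard_ball1_le {d : ℕ} (hd : 0 < d) (Γ γ : ℕ → ℝ) (k : ℕ) {θ : ℝ}
    (hθ : 0 ≤ θ) (hΓ : 2 ≤ Γ k) (hθΓ : 10 * θ ≤ Γ k) (hγ : Γ k < γ k / 2) :
    4 * (ball1 (0 : ZLat d) θ).ncard ≤ (annulus Γ γ k (0 : ZLat d)).ncard := by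
  obtain ⟨c, hc1, hc2⟩ : ∃ c : ℤ, (Γ k - 1) / 2 + θ < c ∧ (c : ℝ) ≤ (Γ k - 1) / 2 + θ + 1 :=
    ⟨⌊(Γ k - 1) / 2 + θ⌋ + 1, by push_cast; exact Int.lt_floor_add_one _,
      by push_cast; linarith [Int.floor_le ((Γ k - 1) / 2 + θ)]⟩
  obtain ⟨s, hs1, hs2⟩ : ∃ s : ℤ, 2 * θ < s ∧ (s : ℝ) ≤ 2 * θ + 1 :=
    ⟨⌊2 * θ⌋ + 1, by push_cast; exact Int.lt_floor_add_one _,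
      by push_cast; linarith [Int.floor_le (2 * θ)]⟩
  let t : Fin 4 → ℤ := ![c, c + s, -c, -(c + s)]
  have ht (i : Fin 4) : (Γ k - 1) / 2 + θ < |(t i : ℝ)| ∧ |(t i : ℝ)| + θ ≤ 3 * Γ k := by
    have h0 : 0 < (c : ℝ) := by linarith
    have h1 : 0 < (c : ℝ) + s := by linarith
    fin_cases i <;> simp only [t] <;> simp [-neg_add_rev, abs_neg, abs_of_pos h0, abs_of_pos h1] <;>
      constructor <;> linarith
  have hsep (i j : Fin 4) (h : |(t i : ℝ) - t j| ≤ 2 * θ) : i = j := by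
    have h' := abs_le.1 h
    fin_cases i <;> fin_cases j <;> first | rfl | (exfalso; simp [t] at h'; linarith)
  let i₀ : Fin d := ⟨0, hd⟩
  let f : Fin 4 × ZLat d → ZLat d := fun p => Pi.single i₀ (t p.1) + p.2
  have hf : Set.InjOn f (Set.univ ×ˢ ball1 0 θ) := by
    rintro ⟨i, u⟩ ⟨-, hu⟩ ⟨j, v⟩ ⟨-, hv⟩ h
    have huv : (D1 u v : ℝ) ≤ 2 * θ := by
      have := D1_triangle_real u 0 v
      rw [D1_comm u 0] at this
      simp only [ball1, Set.mem_ofPred_eq] at hu hv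
      linarith
    have hij : i = j := by
      apply hsep
      have h0 := congrFun h i₀
      simp only [f, Pi.add_apply, Pi.single_eq_same] at h0
      have h1 : ((t i - t j).natAbs : ℝ) ≤ D1 u v := by
        have := natAbs_sub_le_D1 u v i₀
        have h2 : (t i - t j).natAbs = (u i₀ - v i₀).natAbs := by omega
        rw [h2]
        exact_mod_cast this
      rw [Nat.cast_natAbs] at h1
      push_cast at h1
      linarith
    subst hij
    simpa [f] using h
  have hmaps : f '' (Set.univ ×ˢ ball1 0 θ) ⊆ annulus Γ γ k 0 := by
    rintro _ ⟨⟨i, u⟩, ⟨-, hu⟩, rfl⟩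
    have h1 : (D1 0 (Pi.single i₀ (t i)) : ℝ) = |(t i : ℝ)| := by
      rw [D1_zero_single, Nat.cast_natAbs, Int.cast_abs]
    have h2 : D1 (Pi.single i₀ (t i)) (f (i, u)) = D1 0 u := by
      have := D1_add_left (Pi.single i₀ (t i)) 0 u
      simpa [f] using this
    have h3 := D1_triangle_real 0 (Pi.single i₀ (t i)) (f (i, u))
    have h4 := D1_triangle_real 0 (f (i, u)) (Pi.single i₀ (t i))
    rw [D1_comm (f (i, u)), h2] at h4
    rw [h2] at h3
    simp only [ball1, Set.mem_ofPred_eq] at hu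
    obtain ⟨h5, h6⟩ := ht i
    constructor <;> simp only [ball1, Set.mem_ofPred_eq] <;> linarith
  calc 4 * (ball1 (0 : ZLat d) θ).ncard
      = ((Set.univ : Set (Fin 4)) ×ˢ ball1 (0 : ZLat d) θ).ncard := by
        rw [Set.ncard_prod, Set.ncard_univ, Nat.card_fin]
    _ = (f '' (Set.univ ×ˢ ball1 0 θ)).ncard := hf.ncard_image.symm
    _ ≤ _ := Set.ncard_le_ncard hmaps (annulus_finite _ _ _ _)

/-! ### Scales -/

namespace ModSteep

variable {d : ℕ} {Γ γ : ℕ → ℝ} {a ε : ℝ}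

lemma gammaBig_nonneg (hs : ModSteep d Γ γ a ε) (k : ℕ) : 0 ≤ Γ k :=
  hs.gammaBigZero ▸ hs.gammaBigMono.monotone (Nat.zero_le k)

lemma gammaSmall_nonneg (hs : ModSteep d Γ γ a ε) (k : ℕ) : 0 ≤ γ k :=
  hs.gammaSmallZero.trans (hs.gammaSmallMono.monotone (Nat.zero_le k))

lemma two_le_gammaBig_succ (hs : ModSteep d Γ γ a ε) (k : ℕ) : 2 ≤ Γ (k + 1) :=
  hs.gammaBigOne.trans (hs.gammaBigMono.monotone (by omega))

lemma theta_nonneg (hs : ModSteep d Γ γ a ε) (k : ℕ) : 0 ≤ theta Γ γ k :=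
  Finset.sum_nonneg fun i _ => add_nonneg (hs.gammaBig_nonneg i) (hs.gammaSmall_nonneg i)

end ModSteep

/-! ### Locality of the classification -/

lemma gentleOn_of_agree {d : ℕ} {Γ γ : ℕ → ℝ} {B B' : Set (ZLat d)} {k : ℕ} {x : ZLat d}
    (hΓ : 0 ≤ Γ k) (hγ : 0 ≤ γ k) (h : ∀ z ∈ ball1 x (Γ k + γ k), z ∈ B ↔ z ∈ B')
    (hg : gentleOn Γ γ B k x) : gentleOn Γ γ B' k x := by
  obtain ⟨h1, h2, h3⟩ := hg
  have hsmall : ∀ z ∈ ball1 x (Γ k) ∩ B', z ∈ ball1 x (Γ k) ∩ B := by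
    rintro z ⟨hz, hz'⟩
    refine ⟨hz, (h z ?_).2 hz'⟩
    simp only [ball1, Set.mem_ofPred_eq] at hz ⊢
    linarith
  refine ⟨(h x ?_).1 h1, fun u hu v hv => h2 u (hsmall u hu) v (hsmall v hv), ?_⟩
  · simp only [ball1, Set.mem_ofPred_eq, D1_self]
    push_cast
    linarith
  · rintro u hu v ⟨hv, hv'⟩
    by_contra! hle
    have hxv : v ∈ ball1 x (Γ k + γ k) := by
      have := D1_triangle_real x u v
      have hu' := hu.1
      simp only [ball1, Set.mem_ofPred_eq] at hu' ⊢
      linarith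
    exact absurd (h3 u (hsmall u hu) v
      ⟨(h v hxv).2 hv, fun hmem => hv' ⟨hmem.1, hv⟩⟩) (not_lt.2 hle)

lemma mem_badSet_of_agree {d : ℕ} {Γ γ : ℕ → ℝ} (hΓ : ∀ k, 0 ≤ Γ k) (hγ : ∀ k, 0 ≤ γ k)
    (k : ℕ) : ∀ (x : ZLat d) (σ τ : DConf d), (∀ z ∈ ball1 x (theta Γ γ k), σ z = τ z) →
      (x ∈ badSet Γ γ σ k ↔ x ∈ badSet Γ γ τ k) := by
  induction k with
  | zero =>
    intro x σ τ h
    have hx : σ x = τ x := h x (by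
      simp only [ball1, theta, Set.mem_ofPred_eq, D1_self]
      simpa using add_nonneg (hΓ 0) (hγ 0))
    simp [badSet, hx]
  | succ k ih =>
    intro x σ τ h
    have hθ : theta Γ γ (k + 1) = theta Γ γ k + (Γ (k + 1) + γ (k + 1)) :=
      Finset.sum_range_succ _ _
    have key (z) (hz : z ∈ ball1 x (Γ (k + 1) + γ (k + 1))) :
        z ∈ badSet Γ γ σ k ↔ z ∈ badSet Γ γ τ k := by
      refine ih z σ τ fun w hw => h w ?_
      have := D1_triangle_real x z w
      simp only [ball1, Set.mem_ofPred_eq] at hz hw ⊢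
      linarith
    have hx : x ∈ badSet Γ γ σ k ↔ x ∈ badSet Γ γ τ k := key x (by
      simp only [ball1, Set.mem_ofPred_eq, D1_self]
      simpa using add_nonneg (hΓ (k + 1)) (hγ (k + 1)))
    have hg : gentleOn Γ γ (badSet Γ γ σ k) (k + 1) x ↔
        gentleOn Γ γ (badSet Γ γ τ k) (k + 1) x :=
      ⟨gentleOn_of_agree (hΓ _) (hγ _) key,
        gentleOn_of_agree (hΓ _) (hγ _) fun z hz => (key z hz).symm⟩
    simp only [badSet, Set.mem_ofPred_eq, hx, hg]

lemma exists_mem_annulus_of_mem_badSet_succ {d : ℕ} {Γ γ : ℕ → ℝ} {ω : DConf d} {k : ℕ}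
    {x : ZLat d} (hγ : 0 ≤ γ (k + 1))
    (hx : x ∈ badSet Γ γ ω (k + 1)) :
    x ∈ badSet Γ γ ω k ∧ ∃ y ∈ annulus Γ γ (k + 1) x, y ∈ badSet Γ γ ω k := by
  obtain ⟨hxk, hng⟩ := hx
  refine ⟨hxk, ?_⟩
  by_contra! hno
  have hclose (u) (hu : u ∈ badSet Γ γ ω k) (hur : (D1 x u : ℝ) ≤ γ (k + 1) + Γ (k + 1)) :
      (D1 x u : ℝ) ≤ (Γ (k + 1) - 1) / 2 := by
    by_contra hfar
    exact hno u ⟨hur, hfar⟩ hu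
  refine hng ⟨hxk, ?_, ?_⟩
  · rintro u ⟨hu, hu'⟩ v ⟨hv, hv'⟩
    simp only [ball1, Set.mem_ofPred_eq] at hu hv
    have h1 := hclose u hu' (by linarith)
    have h2 := hclose v hv' (by linarith)
    have := D1_triangle_real u x v
    rw [D1_comm u x] at this
    linarith
  · rintro u ⟨hu, hu'⟩ v ⟨hv, hv'⟩
    by_contra! hle
    simp only [ball1, Set.mem_ofPred_eq] at hu
    have h3 := D1_triangle_real x u v
    have h2 := hclose v hv (by linarith)
    refine hv' ⟨?_, hv⟩
    simp only [ball1, Set.mem_ofPred_eq]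
    linarith

/-! ### Local events -/

lemma measurableSet_of_local {d : ℕ} (S : Finset (ZLat d)) (E : Set (DConf d))
    (hE : ∀ σ τ : DConf d, (∀ x ∈ S, σ x = τ x) → (σ ∈ E ↔ τ ∈ E)) : MeasurableSet E := by
  have h : E = S.restrict ⁻¹' (S.restrict '' E) := by
    refine Set.Subset.antisymm (Set.subset_preimage_image _ _) ?_
    rintro ω ⟨σ, hσ, h⟩
    exact (hE σ ω fun x hx => congrFun h ⟨x, hx⟩).1 hσ
  rw [h]
  exact Finset.measurable_restrict S (Set.toFinite _).measurableSet

lemma localOn_indicator {d : ℕ} (S : Finset (ZLat d)) (E : Set (DConf d))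
    (hE : ∀ σ τ : DConf d, (∀ x ∈ S, σ x = τ x) → (σ ∈ E ↔ τ ∈ E)) :
    LocalOn (E.indicator (1 : DConf d → ℝ)) S := by
  intro σ τ h
  by_cases hσ : σ ∈ E
  · rw [Set.indicator_of_mem hσ, Set.indicator_of_mem ((hE σ τ h).1 hσ)]
    rfl
  · rw [Set.indicator_of_notMem hσ, Set.indicator_of_notMem fun hτ => hσ ((hE σ τ h).2 hτ)]

lemma supNorm_nonneg {α : Type*} (f : α → ℝ) : 0 ≤ supNorm f :=
  Real.iSup_nonneg fun _ => abs_nonneg _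

lemma supNorm_indicator_le_one {d : ℕ} (E : Set (DConf d)) :
    supNorm (E.indicator (1 : DConf d → ℝ)) ≤ 1 := by
  refine ciSup_le fun ω => ?_
  by_cases h : ω ∈ E <;> simp [h]

/-- The decay condition applied to indicators of local events whose supports are at distance at
least `L`. -/
lemma Smin.abs_measureReal_inter_sub_le {d : ℕ} {Q : Measure (DConf d)} {b'' B'' : ℝ}
    (hQ : Smin Q b'' B'') (hb : 0 < b'') (hB : 0 < B'') {E F : Set (DConf d)}
    {S T : Finset (ZLat d)} {L : ℝ} (hS : S.Nonempty) (hT : T.Nonempty)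
    (hE : ∀ σ τ : DConf d, (∀ x ∈ S, σ x = τ x) → (σ ∈ E ↔ τ ∈ E))
    (hF : ∀ σ τ : DConf d, (∀ x ∈ T, σ x = τ x) → (σ ∈ F ↔ τ ∈ F))
    (hL : ∀ x ∈ S, ∀ y ∈ T, L ≤ D1 x y) (hcard : S.card * Real.exp (-b'' * L) ≤ 1) :
    |Q.real (E ∩ F) - Q.real E * Q.real F| ≤ B'' * S.card * Real.exp (-b'' * L) := by
  have hdist : L ≤ fDist1 S T := by
    obtain ⟨x, hx⟩ := hS
    obtain ⟨y, hy⟩ := hT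
    refine le_csInf ⟨_, ⟨(x, y), ⟨hx, hy⟩, rfl⟩⟩ ?_
    rintro _ ⟨p, ⟨hp1, hp2⟩, rfl⟩
    exact hL _ hp1 _ hp2
  have hexp : Real.exp (-b'' * fDist1 S T) ≤ Real.exp (-b'' * L) :=
    Real.exp_le_exp.2 (by nlinarith)
  have hmin : (min S.card T.card : ℝ) ≤ S.card := min_le_left _ _
  have hmin0 : (0 : ℝ) ≤ min (S.card : ℝ) T.card := by positivity
  have hprod : (min S.card T.card : ℝ) * Real.exp (-b'' * fDist1 S T) ≤
      S.card * Real.exp (-b'' * L) := by gcongr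
  have hEm := measurableSet_of_local S E hE
  have hFm := measurableSet_of_local T F hF
  have h := hQ _ _ S T (localOn_indicator S E hE) (localOn_indicator T F hF) (hprod.trans hcard)
  have hmul : (fun ω => E.indicator (1 : DConf d → ℝ) ω * F.indicator (1 : DConf d → ℝ) ω) =
      (E ∩ F).indicator 1 := by
    rw [Set.inter_indicator_one]
    rfl
  rw [hmul, integral_indicator_one (hEm.inter hFm), integral_indicator_one hEm,
    integral_indicator_one hFm] at h
  refine h.trans ?_
  have hsup : supNorm (E.indicator (1 : DConf d → ℝ)) * supNorm (F.indicator (1 : DConf d → ℝ))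
      ≤ 1 :=
    mul_le_one₀ (supNorm_indicator_le_one E) (supNorm_nonneg _) (supNorm_indicator_le_one F)
  have hsup0 := mul_nonneg (supNorm_nonneg (E.indicator (1 : DConf d → ℝ)))
    (supNorm_nonneg (F.indicator (1 : DConf d → ℝ)))
  calc _ = B'' * (supNorm (E.indicator (1 : DConf d → ℝ)) *
          supNorm (F.indicator (1 : DConf d → ℝ))) *
          ((min S.card T.card : ℝ) * Real.exp (-b'' * fDist1 S T)) := by ring
    _ ≤ B'' * 1 * (S.card * Real.exp (-b'' * L)) := by gcongr
    _ = _ := by ring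

/-- Under the decay condition every site takes its more likely value up to probability
`2 B''`. -/
lemma Smin.exists_mode {d : ℕ} {Q : Measure (DConf d)} [IsProbabilityMeasure Q] {b'' B'' : ℝ}
    (hQ : Smin Q b'' B'') (hb : 0 < b'') (hB : 0 < B'') :
    ∃ m : DConf d, ∀ x, Q.real {ω | ω x ≠ m x} ≤ 2 * B'' := by
  suffices h : ∀ x, ∃ c : Bool, Q.real {ω | ω x ≠ c} ≤ 2 * B'' by
    choose m hm using h
    exact ⟨m, hm⟩
  intro x
  have hloc (σ τ : DConf d) (h : ∀ y ∈ ({x} : Finset (ZLat d)), σ y = τ y) :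
      σ ∈ {ω : DConf d | ω x = true} ↔ τ ∈ {ω : DConf d | ω x = true} := by
    simp [h x (by simp)]
  have hvar := hQ.abs_measureReal_inter_sub_le (L := 0) hb hB (Finset.singleton_nonempty x)
    (Finset.singleton_nonempty x) hloc hloc (fun _ _ _ _ => Nat.cast_nonneg _) (by simp)
  rw [Set.inter_self] at hvar
  simp only [Finset.card_singleton, Nat.cast_one, mul_one, mul_zero, Real.exp_zero] at hvar
  have hvar' := (abs_le.1 hvar).2
  have hcompl : Q.real {ω : DConf d | ω x ≠ true} = 1 - Q.real {ω : DConf d | ω x = true} :=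
    probReal_compl_eq_one_sub (measurableSet_of_local {x} _ hloc)
  set q := Q.real {ω : DConf d | ω x = true}
  have hq0 : 0 ≤ q := measureReal_nonneg
  have hq1 : q ≤ 1 := measureReal_le_one
  rcases le_total q (1 / 2) with hq | hq
  · refine ⟨false, ?_⟩
    have : {ω : DConf d | ω x ≠ false} = {ω : DConf d | ω x = true} := by simp
    rw [this]
    nlinarith
  · refine ⟨true, ?_⟩
    rw [hcompl]
    nlinarith

/-- A local event whose support has `n` sites has probability at most `2 n B''` or at least
`1 - 2 n B''`. -/
lemma Smin.measureReal_le_or_ge {d : ℕ} {Q : Measure (DConf d)} [IsProbabilityMeasure Q]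
    {b'' B'' : ℝ} (hQ : Smin Q b'' B'') (hb : 0 < b'') (hB : 0 < B'') {E : Set (DConf d)}
    {S : Finset (ZLat d)}
    (hE : ∀ σ τ : DConf d, (∀ x ∈ S, σ x = τ x) → (σ ∈ E ↔ τ ∈ E)) :
    Q.real E ≤ 2 * S.card * B'' ∨ 1 - 2 * S.card * B'' ≤ Q.real E := by
  obtain ⟨m, hm⟩ := hQ.exists_mode hb hB
  have hbad : Q.real (⋃ x ∈ S, {ω : DConf d | ω x ≠ m x}) ≤ 2 * S.card * B'' := by
    refine (measureReal_biUnion_finset_le _ _).trans ?_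
    refine (Finset.sum_le_sum fun x _ => hm x).trans ?_
    rw [Finset.sum_const, nsmul_eq_mul]
    linarith
  have hagree (ω : DConf d) (hω : ω ∉ ⋃ x ∈ S, {ω : DConf d | ω x ≠ m x}) : ω ∈ E ↔ m ∈ E := by
    refine hE ω m fun x hx => ?_
    by_contra hne
    exact hω (Set.mem_biUnion hx hne)
  by_cases hmE : m ∈ E
  · right
    have hsub : Eᶜ ⊆ ⋃ x ∈ S, {ω : DConf d | ω x ≠ m x} := by
      intro ω hω
      by_contra hno
      exact hω ((hagree ω hno).2 hmE)
    have h1 := measureReal_mono (μ := Q) hsub (measure_ne_top _ _)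
    rw [probReal_compl_eq_one_sub (measurableSet_of_local S E hE)] at h1
    linarith
  · left
    refine (measureReal_mono (fun ω hω => ?_) (measure_ne_top _ _)).trans hbad
    by_contra hno
    exact hmE ((hagree ω hno).1 hω)

/-- The event `x ∈ B_k` depends only on the sites in the ball `O_{θ_k}(x)`. -/
lemma badSet_local {d : ℕ} {Γ γ : ℕ → ℝ} {a ε : ℝ} (hs : ModSteep d Γ γ a ε) (k : ℕ)
    (x : ZLat d) (σ τ : DConf d)
    (h : ∀ z ∈ (ball1_finite x (theta Γ γ k)).toFinset, σ z = τ z) :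
    σ ∈ {ω | x ∈ badSet Γ γ ω k} ↔ τ ∈ {ω | x ∈ badSet Γ γ ω k} :=
  mem_badSet_of_agree hs.gammaBig_nonneg hs.gammaSmall_nonneg k x σ τ fun z hz =>
    h z (by simpa using hz)

/-- The recursive estimate for a uniform bound `p` on the probabilities of `k`-badness. -/
lemma measureReal_badSet_succ_le {d : ℕ} {Γ γ : ℕ → ℝ} {a ε : ℝ} (hs : ModSteep d Γ γ a ε)
    {Q : Measure (DConf d)} [IsProbabilityMeasure Q] {b'' B'' : ℝ} (hb : 0 < b'') (hB : 0 < B'')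
    (hQ : Smin Q b'' B'') (k : ℕ) {p : ℝ} (hp : ∀ x, Q.real {ω | x ∈ badSet Γ γ ω k} ≤ p)
    (x : ZLat d) :
    Q.real {ω | x ∈ badSet Γ γ ω (k + 1)} ≤
      ((annulus Γ γ (k + 1) (0 : ZLat d)).ncard : ℝ) *
        (p ^ 2 + B'' * ((ball1 (0 : ZLat d) (theta Γ γ k)).ncard : ℝ) *
          Real.exp (-b'' * Γ (k + 1) / 20)) := by
  have hΓ2 := hs.two_le_gammaBig_succ k
  have hθ := hs.theta_nonneg k
  have hlam := hs.lam k
  have hp0 : 0 ≤ p := measureReal_nonneg.trans (hp x)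
  set A := annulus Γ γ (k + 1) x with hA
  have hAfin : A.Finite := annulus_finite _ _ _ _
  let S (y : ZLat d) : Finset (ZLat d) := (ball1_finite y (theta Γ γ k)).toFinset
  have hScard (y : ZLat d) : (S y).card = (ball1 (0 : ZLat d) (theta Γ γ k)).ncard := by
    rw [← ncard_ball1 y, Set.ncard_eq_toFinset_card _ (ball1_finite y (theta Γ γ k))]
  have hSne (y : ZLat d) : (S y).Nonempty := ⟨y, by simpa [S, ball1, D1_self] using hθ⟩
  have hsub : {ω | x ∈ badSet Γ γ ω (k + 1)} ⊆
      ⋃ y ∈ hAfin.toFinset, {ω | x ∈ badSet Γ γ ω k} ∩ {ω | y ∈ badSet Γ γ ω k} := by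
    intro ω hω
    obtain ⟨h1, y, hy, h2⟩ := exists_mem_annulus_of_mem_badSet_succ
      (hs.gammaSmall_nonneg _) hω
    exact Set.mem_biUnion (by simpa using hy) ⟨h1, h2⟩
  rw [show -b'' * Γ (k + 1) / 20 = -b'' * (Γ (k + 1) / 20) by ring]
  set N := (ball1 (0 : ZLat d) (theta Γ γ k)).ncard with hN
  set e := Real.exp (-b'' * (Γ (k + 1) / 20)) with he
  have he0 : 0 < e := Real.exp_pos _
  rcases le_or_gt (N * e) 1 with hsmall | hlarge
  · have hpair (y) (hy : y ∈ A) :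
        Q.real ({ω | x ∈ badSet Γ γ ω k} ∩ {ω | y ∈ badSet Γ γ ω k}) ≤
          p ^ 2 + B'' * N * e := by
      have hdist : ∀ u ∈ S x, ∀ v ∈ S y, Γ (k + 1) / 20 ≤ D1 u v := by
        intro u hu v hv
        have hu' : (D1 x u : ℝ) ≤ theta Γ γ k := by simpa [S, ball1] using hu
        have hv' : (D1 y v : ℝ) ≤ theta Γ γ k := by simpa [S, ball1] using hv
        have hxy : (Γ (k + 1) - 1) / 2 < D1 x y := not_le.1 hy.2
        have h1 := D1_triangle_real x u y
        have h2 := D1_triangle_real u v y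
        rw [D1_comm v y] at h2
        linarith
      have h := hQ.abs_measureReal_inter_sub_le hb hB (hSne x) (hSne y)
        (badSet_local hs k x) (badSet_local hs k y) hdist (by rw [hScard]; exact hsmall)
      rw [hScard] at h
      have hmul : Q.real {ω | x ∈ badSet Γ γ ω k} * Q.real {ω | y ∈ badSet Γ γ ω k} ≤ p ^ 2 := by
        rw [sq]
        exact mul_le_mul (hp x) (hp y) measureReal_nonneg hp0
      linarith [(abs_le.1 h).2]
    calc _ ≤ _ := measureReal_mono hsub (measure_ne_top _ _)
      _ ≤ _ := measureReal_biUnion_finset_le _ _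
      _ ≤ ∑ y ∈ hAfin.toFinset, (p ^ 2 + B'' * N * e) :=
        Finset.sum_le_sum fun y hy => hpair y (by simpa using hy)
      _ = _ := by
        rw [Finset.sum_const, nsmul_eq_mul, ← Set.ncard_eq_toFinset_card _ hAfin, hA,
          ncard_annulus]
  · rcases Nat.eq_zero_or_pos d with rfl | hd
    · have hempty : {ω | x ∈ badSet Γ γ ω (k + 1)} = ∅ := by
        refine Set.eq_empty_of_forall_notMem fun ω hω => ?_
        obtain ⟨-, y, hy, -⟩ := exists_mem_annulus_of_mem_badSet_succ
          (hs.gammaSmall_nonneg _) hω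
        refine hy.2 ?_
        simp only [ball1, D1, Set.mem_ofPred_eq, Finset.univ_eq_empty, Finset.sum_empty]
        push_cast
        linarith
      rw [hempty, measureReal_empty]
      positivity
    · have hcard := four_mul_ncard_ball1_le hd Γ γ (k + 1) hθ hΓ2 hlam
        (hs.halfLt (k + 1) (by omega))
      rw [← hN] at hcard
      set M := (annulus Γ γ (k + 1) (0 : ZLat d)).ncard
      have hcard' : (4 : ℝ) * N ≤ M := by exact_mod_cast hcard
      have hN1 : (1 : ℝ) ≤ N := by
        rw [← hScard x]
        exact_mod_cast (hSne x).card_pos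
      have hle : Q.real {ω | x ∈ badSet Γ γ ω (k + 1)} ≤ Q.real {ω | x ∈ badSet Γ γ ω k} :=
        measureReal_mono fun ω hω => hω.1
      have hrhs : M * p ^ 2 + 4 * N * B'' ≤ M * (p ^ 2 + B'' * N * e) := by
        have h1 : B'' ≤ B'' * (N * e) := le_mul_of_one_le_right hB.le hlarge.le
        have h2 : 4 * N * B'' ≤ M * (B'' * (N * e)) := by gcongr
        linarith
      refine le_trans ?_ hrhs
      have hNB : 0 ≤ N * B'' := by positivity
      have hap : 4 * p ^ 2 ≤ M * p ^ 2 := by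
        gcongr
        linarith
      rcases hQ.measureReal_le_or_ge hb hB (badSet_local hs k x) with h | h
      · rw [hScard] at h
        nlinarith [sq_nonneg p]
      · rw [hScard] at h
        have h1 : Q.real {ω | x ∈ badSet Γ γ ω (k + 1)} ≤ 1 := measureReal_le_one
        have h2 := h.trans (hp x)
        nlinarith [sq_nonneg (2 * p - 1)]

/-- Recursive estimate on the badness probability. With
`p_k = sup_x Q(x ∈ B_k)`, for every `k`:
`p_{k+1} ≤ |A_{k+1}| (p_k² + B'' |O_{θ_k}| exp(−b'' Γ_{k+1}/20))`. -/
theorem stmt6 {d : ℕ} (Γ γ : ℕ → ℝ) (a ε : ℝ) (hs : ModSteep d Γ γ a ε)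
    (Q : Measure (DConf d)) [IsProbabilityMeasure Q]
    (b'' B'' : ℝ) (hb : 0 < b'') (hB : 0 < B'') (hQ : Smin Q b'' B'') :
    ∀ k : ℕ,
      (⨆ x : ZLat d, Q {ω | x ∈ badSet Γ γ ω (k + 1)}) ≤
        ((annulus Γ γ (k + 1) (0 : ZLat d)).ncard : ENNReal) *
          ((⨆ x : ZLat d, Q {ω | x ∈ badSet Γ γ ω k}) ^ 2 +
            ENNReal.ofReal
              (B'' * ((ball1 (0 : ZLat d) (theta Γ γ k)).ncard : ℝ) *
                Real.exp (-b'' * Γ (k + 1) / 20))) := by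
  intro k
  set P := ⨆ x : ZLat d, Q {ω | x ∈ badSet Γ γ ω k} with hP
  have hP1 : P ≠ ⊤ := ne_top_of_le_ne_top ENNReal.one_ne_top (iSup_le fun _ => prob_le_one)
  refine iSup_le fun x => ?_
  have h := measureReal_badSet_succ_le hs hb hB hQ k (p := P.toReal)
    (fun y => ENNReal.toReal_mono hP1 (le_iSup (fun y => Q {ω | y ∈ badSet Γ γ ω k}) y)) x
  rw [← ENNReal.ofReal_toReal (measure_ne_top Q _)]
  refine (ENNReal.ofReal_le_ofReal h).trans_eq ?_
  rw [ENNReal.ofReal_mul (Nat.cast_nonneg _), ENNReal.ofReal_natCast,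
    ENNReal.ofReal_add (by positivity) (by positivity),
    ENNReal.ofReal_pow ENNReal.toReal_nonneg, ENNReal.ofReal_toReal hP1]

end

end Paper
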